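/- Let Λ be a finite-dimensional algebra over an algebraically closed field k. If a simple Λ-module S has finite projective dimension, then Ext¹_Λ(S, S) = 0. (The strong no loop conjecture for algebras over algebraically closed fields.) -/

import Mathlib

universe u

/-- The commutator subgroup [R,R]: additive subgroup generated by ab - ba. -/
def commSub (R : Type*) [Ring R] : AddSubgroup R :=
  AddSubgroup.closure {x | ∃ a b : R, x = a * b - b * a}

/-- The quotient ring Λ_e = Λ/Λ(1-e)Λ. -/
abbrev corner (Λ : Type*) [Ring Λ] (e : Λ) :=
  (TwoSidedIdeal.span {1 - e}).ringCon.Quotient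

/-- The canonical projection Λ → Λ_e. -/
abbrev cornerProj (Λ : Type*) [Ring Λ] (e : Λ) : Λ →+* corner Λ e :=
  (TwoSidedIdeal.span {1 - e}).ringCon.mk'

/-- The Jacobson radical of Λ, via the classical characterization:
x ∈ J(Λ) iff 1 - yx is invertible for every y. -/
def Jset (Λ : Type*) [Ring Λ] : Set Λ := {x | ∀ y : Λ, IsUnit (1 - y * x)}

/-- The square J² of the Jacobson radical, as an additive subgroup. -/
def Jsq (Λ : Type*) [Ring Λ] : AddSubgroup Λ :=
  AddSubgroup.closure {x | ∃ a ∈ Jset Λ, ∃ b ∈ Jset Λ, x = a * b}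

/-- The right ideal eΛ as a Λᵐᵒᵖ-submodule of Λ. -/
def eSub (Λ : Type*) [Ring Λ] (e : Λ) : Submodule Λᵐᵒᵖ Λ where
  carrier := {x | e * x = x}
  add_mem' := by intro x y hx hy; simp only [Set.mem_setOf_eq] at *; rw [mul_add, hx, hy]
  zero_mem' := by simp
  smul_mem' := by
    intro c x hx
    simp only [Set.mem_setOf_eq, MulOpposite.smul_eq_mul_unop, ← mul_assoc] at *
    rw [hx]

/-- The semisimple right Λ-module S_e = eΛ/eJ. -/
abbrev SeMod (Λ : Type*) [Ring Λ] (e : Λ) :=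
  (eSub Λ e) ⧸ (Submodule.span Λᵐᵒᵖ {x : eSub Λ e | (x : Λ) ∈ Jset Λ})

/-- A right Λ-module M has finite injective dimension: it admits a finite injective
coresolution 0 → M → I⁰ → I¹ → ⋯ with Iⁱ = 0 for all large i. -/
def FinInjDim (Λ : Type u) [Ring Λ] (M : Type u) [AddCommGroup M] [Module Λᵐᵒᵖ M] : Prop :=
  ∃ (I : ℕ → ModuleCat.{u} Λᵐᵒᵖ) (f : ∀ i, I i →ₗ[Λᵐᵒᵖ] I (i+1)) (g : M →ₗ[Λᵐᵒᵖ] I 0),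
    (∀ i, Module.Injective Λᵐᵒᵖ (I i)) ∧ Function.Injective g ∧
    LinearMap.ker (f 0) = LinearMap.range g ∧
    (∀ i, LinearMap.ker (f (i+1)) = LinearMap.range (f i)) ∧
    ∃ N, ∀ i ≥ N, Subsingleton (I i)

/-- A right Λ-module M has finite projective dimension: it admits a finite projective
resolution ⋯ → P₁ → P₀ → M → 0 with Pᵢ = 0 for all large i. -/
def FinProjDim (Λ : Type u) [Ring Λ] (M : Type u) [AddCommGroup M] [Module Λᵐᵒᵖ M] : Prop :=
  ∃ (P : ℕ → ModuleCat.{u} Λᵐᵒᵖ) (f : ∀ i, P (i+1) →ₗ[Λᵐᵒᵖ] P i) (g : P 0 →ₗ[Λᵐᵒᵖ] M),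
    (∀ i, Module.Projective Λᵐᵒᵖ (P i)) ∧ Function.Surjective g ∧
    LinearMap.ker g = LinearMap.range (f 0) ∧
    (∀ i, LinearMap.ker (f i) = LinearMap.range (f (i+1))) ∧
    ∃ N, ∀ i ≥ N, Subsingleton (P i)

/-- Ext¹_Λ(S,S) = 0, expressed as: every short exact sequence 0 → S → E → S → 0 of right
Λ-modules splits. -/
def Ext1SelfVanishes (Λ : Type u) [Ring Λ] (S : Type u) [AddCommGroup S]
    [Module Λᵐᵒᵖ S] : Prop :=
  ∀ (E : Type u) [AddCommGroup E] [Module Λᵐᵒᵖ E]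
    (i : S →ₗ[Λᵐᵒᵖ] E) (p : E →ₗ[Λᵐᵒᵖ] S),
    Function.Injective i → Function.Surjective p → LinearMap.ker p = LinearMap.range i →
    ∃ r : E →ₗ[Λᵐᵒᵖ] S, ∀ x, r (i x) = x

/-- An idempotent u is primitive if it is nonzero and is not the sum of two orthogonal
nonzero idempotents. -/
def IsPrimitiveIdem {Λ : Type*} [Ring Λ] (u : Λ) : Prop :=
  u ≠ 0 ∧ IsIdempotentElem u ∧ ∀ f g : Λ, IsIdempotentElem f → IsIdempotentElem g →
    f * g = 0 → g * f = 0 → f + g = u → f = 0 ∨ g = 0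

/-- A primitive idempotent e is basic if eΛ is not isomorphic to a direct summand of
(1-e)Λ; equivalently, there are no u ∈ eΛ(1-e), v ∈ (1-e)Λe with uv = e. -/
def IsBasicIdem {Λ : Type*} [Ring Λ] (e : Λ) : Prop :=
  IsPrimitiveIdem e ∧
    ¬ ∃ u v : Λ, u = e * u * (1 - e) ∧ v = (1 - e) * v * e ∧ u * v = e


section NLLinear
variable {k : Type u} [Field k]

/-- trace additivity along an exact sequence -/
theorem nl_trace_add {H' H H'' : Type u} [AddCommGroup H'] [Module k H'] [AddCommGroup H]
    [Module k H] [AddCommGroup H''] [Module k H''] [FiniteDimensional k H']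
    [FiniteDimensional k H] [FiniteDimensional k H'']
    (a : H' →ₗ[k] H) (b : H →ₗ[k] H'') (r : H →ₗ[k] H') (σ : H'' →ₗ[k] H)
    (hra : r ∘ₗ a = LinearMap.id) (hbs : b ∘ₗ σ = LinearMap.id)
    (h1 : a ∘ₗ r + σ ∘ₗ b = LinearMap.id)
    (T' : Module.End k H') (T : Module.End k H) (T'' : Module.End k H'')
    (h' : T ∘ₗ a = a ∘ₗ T') (h'' : b ∘ₗ T = T'' ∘ₗ b) :
    LinearMap.trace k H T = LinearMap.trace k H' T' + LinearMap.trace k H'' T'' := by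
  have e : T = a ∘ₗ (r ∘ₗ T) + σ ∘ₗ (b ∘ₗ T) := by
    rw [← LinearMap.comp_assoc, ← LinearMap.comp_assoc, ← LinearMap.add_comp, h1,
      LinearMap.id_comp]
  rw [e, map_add, LinearMap.trace_comp_comm', LinearMap.comp_assoc, h', ← LinearMap.comp_assoc,
    hra, LinearMap.id_comp, h'', LinearMap.trace_comp_comm', LinearMap.comp_assoc, hbs,
    LinearMap.comp_id]

/-- splitting data of a short exact sequence of vector spaces -/
theorem nl_split {H' H H'' : Type u} [AddCommGroup H'] [Module k H'] [AddCommGroup H]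
    [Module k H] [AddCommGroup H''] [Module k H'']
    (a : H' →ₗ[k] H) (b : H →ₗ[k] H'') (ha : Function.Injective a) (hb : Function.Surjective b)
    (hab : ∀ x, b x = 0 ↔ ∃ y, a y = x) :
    ∃ (r : H →ₗ[k] H') (σ : H'' →ₗ[k] H), r ∘ₗ a = LinearMap.id ∧ b ∘ₗ σ = LinearMap.id ∧
      a ∘ₗ r + σ ∘ₗ b = LinearMap.id := by
  obtain ⟨σ, hσ⟩ := b.exists_rightInverse_of_surjective (LinearMap.range_eq_top.2 hb)
  obtain ⟨r0, hr0⟩ := a.exists_leftInverse_of_injective (LinearMap.ker_eq_bot.2 ha)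
  have hσ' : ∀ x, b (σ x) = x := fun x => LinearMap.congr_fun hσ x
  have hr0' : ∀ x, r0 (a x) = x := fun x => LinearMap.congr_fun hr0 x
  have hba : ∀ x, b (a x) = 0 := fun x => (hab _).2 ⟨x, rfl⟩
  refine ⟨r0 ∘ₗ (LinearMap.id - σ ∘ₗ b), σ, ?_, hσ, ?_⟩
  · ext x; simp [hba, hr0']
  · ext x
    obtain ⟨y, hy⟩ := (hab (x - σ (b x))).1 (by simp [hσ'])
    simp [← hy, hr0']
    simp [hy]

/-- independence of the contraction -/
theorem nl_indep {H : Type u} [AddCommGroup H] [Module k H]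
    (ε s s' φ : Module.End k H) (hs : s * ε + ε * s = 1) (hs' : s' * ε + ε * s' = 1)
    (hφ : φ * ε = ε * φ) : LinearMap.trace k H (s * φ) = LinearMap.trace k H (s' * φ) := by
  have hu : (s - s') * ε = - (ε * (s - s')) := by
    have : s * ε + ε * s = s' * ε + ε * s' := by rw [hs, hs']
    rw [sub_mul, mul_sub]
    rw [eq_neg_iff_add_eq_zero]
    rw [← sub_eq_zero] at this
    rw [← this]; abel
  have key : (s - s') * φ = (s - s') * s * φ * ε + (s - s') * ε * s * φ := by
    calc (s - s') * φ = (s - s') * (s * ε + ε * s) * φ := by rw [hs, mul_one]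
      _ = _ := by rw [mul_assoc ((s-s') * s) φ ε, hφ]; noncomm_ring
  have : LinearMap.trace k H ((s - s') * φ) = 0 := by
    rw [key, map_add, LinearMap.trace_mul_comm k _ ε, ← map_add, hu]
    have h0 : ε * ((s - s') * s * φ) + -(ε * (s - s')) * s * φ = 0 := by noncomm_ring
    rw [h0, map_zero]
  rw [sub_mul, map_sub, sub_eq_zero] at this
  exact this

/-- the dual-number trace -/
theorem nl_exists {H' H H'' : Type u} [AddCommGroup H'] [Module k H'] [AddCommGroup H]
    [Module k H] [AddCommGroup H''] [Module k H''] [FiniteDimensional k H']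
    [FiniteDimensional k H] [FiniteDimensional k H'']
    (a : H' →ₗ[k] H) (b : H →ₗ[k] H'') (ha : Function.Injective a) (hb : Function.Surjective b)
    (hab : ∀ x, b x = 0 ↔ ∃ y, a y = x)
    (ε' s' φ' : Module.End k H') (ε φ : Module.End k H) (ε'' s'' φ'' : Module.End k H'')
    (hε : ε * ε = 0)
    (hεa : ε ∘ₗ a = a ∘ₗ ε') (hεb : b ∘ₗ ε = ε'' ∘ₗ b)
    (hφa : φ ∘ₗ a = a ∘ₗ φ') (hφb : b ∘ₗ φ = φ'' ∘ₗ b)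
    (hs' : s' * ε' + ε' * s' = 1) (hs'' : s'' * ε'' + ε'' * s'' = 1) :
    ∃ s : Module.End k H, s * ε + ε * s = 1 ∧
      LinearMap.trace k H (s * φ) =
        LinearMap.trace k H' (s' * φ') + LinearMap.trace k H'' (s'' * φ'') := by
  obtain ⟨r, σ, hra, hbs, h1⟩ := nl_split a b ha hb hab
  have hba : b ∘ₗ a = 0 := by ext x; exact (hab _).2 ⟨x, rfl⟩
  let s0 : Module.End k H := a ∘ₗ s' ∘ₗ r + σ ∘ₗ s'' ∘ₗ b
  have hra' := LinearMap.congr_fun hra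
  have hbs' := LinearMap.congr_fun hbs
  have h1' := LinearMap.congr_fun h1
  have hba' := LinearMap.congr_fun hba
  have hεa' := LinearMap.congr_fun hεa
  have hεb' := LinearMap.congr_fun hεb
  have hφa' := LinearMap.congr_fun hφa
  have hφb' := LinearMap.congr_fun hφb
  have hs1' := LinearMap.congr_fun hs'
  have hs1'' := LinearMap.congr_fun hs''
  simp only [LinearMap.comp_apply, LinearMap.add_apply, LinearMap.id_apply, LinearMap.zero_apply,
    Module.End.mul_apply, Module.End.one_apply] at hra' hbs' h1' hba' hεa' hεb' hφa' hφb' hs1' hs1''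
  have hs0a : ∀ x, s0 (a x) = a (s' x) := by intro x; simp [s0, hra', hba']
  have hs0b : ∀ x, b (s0 x) = s'' (b x) := by intro x; simp [s0, hbs', hba']
  let n : Module.End k H := s0 * ε + ε * s0 - 1
  have hna : ∀ x, n (a x) = 0 := by
    intro x; simp [n, hs0a, hεa', ← map_add, hs1']
  have hnb : ∀ x, b (n x) = 0 := by
    intro x; simp [n, hs0b, hεb', hs1'']
  have hnn : n * n = 0 := by
    ext x
    obtain ⟨y, hy⟩ := (hab (n x)).1 (hnb x)
    simp [← hy, hna]
  have hc : s0 * ε + ε * s0 = 1 + n := by simp [n]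
  have hnε : n * ε = ε * n := by
    simp only [n, sub_mul, add_mul, mul_sub, mul_add, ← mul_assoc, hε, mul_one, one_mul, zero_mul]
    simp [mul_assoc, hε]
  refine ⟨s0 * (1 - n), ?_, ?_⟩
  · calc s0 * (1 - n) * ε + ε * (s0 * (1 - n))
        = s0 * (ε - n * ε) + ε * s0 * (1 - n) := by noncomm_ring
      _ = (s0 * ε + ε * s0) * (1 - n) := by rw [hnε]; noncomm_ring
      _ = 1 - n * n := by rw [hc]; noncomm_ring
      _ = 1 := by rw [hnn, sub_zero]
  · apply nl_trace_add a b r σ hra hbs h1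
    · ext x; simp [hφa', hna, hs0a]
    · ext x; simp [hφb', hnb, hs0b]

theorem nl_contr {H : Type u} [AddCommGroup H] [Module k H] (ε : Module.End k H)
    (h : ∀ x, ε x = 0 ↔ ∃ y, ε y = x) : ∃ s : Module.End k H, s * ε + ε * s = 1 := by
  obtain ⟨g, hg⟩ := ε.rangeRestrict.exists_rightInverse_of_surjective
    (LinearMap.range_rangeRestrict ε)
  obtain ⟨q, hq⟩ := (LinearMap.range ε).subtype.exists_leftInverse_of_injective
    (Submodule.ker_subtype _)
  have hg' : ∀ y : LinearMap.range ε, ε (g y) = y := fun y =>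
    congrArg Subtype.val (LinearMap.congr_fun hg y)
  have hq' : ∀ y : LinearMap.range ε, q y = y := fun y => LinearMap.congr_fun hq y
  have hεε : ∀ x, ε (ε x) = 0 := fun x => (h _).2 ⟨x, rfl⟩
  -- s x = g (q (x - g (ε x)))
  let g' : Module.End k H := g ∘ₗ ε.rangeRestrict
  have hg2 : ∀ x, ε (g' x) = ε x := fun x => by simp [g', hg']
  refine ⟨g ∘ₗ q ∘ₗ (LinearMap.id - g'), ?_⟩
  ext x
  have e1 : g' (ε x) = 0 := by
    have : ε.rangeRestrict (ε x) = 0 := by ext; simp [hεε]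
    simp [g', this]
  have e2 : q (ε x) = ε.rangeRestrict x := by
    have := hq' (ε.rangeRestrict x); simpa using this
  obtain ⟨y, hy⟩ := (h (x - g' x)).1 (by simp [hg2])
  have e3 : q (x - g' x) = ε.rangeRestrict y := by
    rw [← hy]; have := hq' (ε.rangeRestrict y); simpa using this
  have e4 : ε (g (q (x - g' x))) = x - g' x := by rw [hg', e3]; simpa using hy
  simp only [LinearMap.add_apply, Module.End.mul_apply, LinearMap.comp_apply, LinearMap.sub_apply,
    LinearMap.id_apply, Module.End.one_apply, e4, e1, sub_zero, e2]
  simp [g']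

end NLLinear

section NLCo
variable (k : Type u) [Field k] (A : Type u) [Ring A] [Algebra k A]

/-- The coinduced module `Hom_k(A, N)`. -/
def NLCo (N : Type u) [AddCommGroup N] [Module k N] : Type u := A →ₗ[k] N

instance (N : Type u) [AddCommGroup N] [Module k N] : AddCommGroup (NLCo k A N) :=
  inferInstanceAs (AddCommGroup (A →ₗ[k] N))
instance (N : Type u) [AddCommGroup N] [Module k N] : Module k (NLCo k A N) :=
  inferInstanceAs (Module k (A →ₗ[k] N))
instance (N : Type u) [AddCommGroup N] [Module k N] [FiniteDimensional k A]
    [FiniteDimensional k N] : FiniteDimensional k (NLCo k A N) :=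
  inferInstanceAs (FiniteDimensional k (A →ₗ[k] N))

variable {k A}

/-- evaluation -/
def NLCo.ev {N : Type u} [AddCommGroup N] [Module k N] (f : NLCo k A N) : A →ₗ[k] N := f
/-- constructor -/
def NLCo.mk {N : Type u} [AddCommGroup N] [Module k N] (f : A →ₗ[k] N) : NLCo k A N := f

section
variable {N : Type u} [AddCommGroup N] [Module k N]

@[simp] theorem NLCo.ev_mk (f : A →ₗ[k] N) : (NLCo.mk f).ev = f := rfl
@[simp] theorem NLCo.ev_add (f g : NLCo k A N) (a : A) : (f + g).ev a = f.ev a + g.ev a := rfl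
@[simp] theorem NLCo.ev_sub (f g : NLCo k A N) (a : A) : (f - g).ev a = f.ev a - g.ev a := rfl
@[simp] theorem NLCo.ev_zero (a : A) : (0 : NLCo k A N).ev a = 0 := rfl
@[simp] theorem NLCo.ev_smul (c : k) (f : NLCo k A N) (a : A) : (c • f).ev a = c • f.ev a := rfl

@[ext] theorem NLCo.ext {f g : NLCo k A N} (h : ∀ a, f.ev a = g.ev a) : f = g :=
  LinearMap.ext h

instance : SMul A (NLCo k A N) := ⟨fun a f => NLCo.mk (f.ev ∘ₗ LinearMap.mulRight k a)⟩

@[simp] theorem NLCo.ev_smulA (a b : A) (f : NLCo k A N) : (a • f).ev b = f.ev (b * a) := rfl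

instance : Module A (NLCo k A N) where
  one_smul f := by ext; simp
  mul_smul a b f := by ext; simp [mul_assoc]
  smul_zero a := by ext; simp
  smul_add a f g := by ext; simp
  add_smul a b f := by ext; simp [mul_add]
  zero_smul f := by ext; simp

instance : IsScalarTower k A (NLCo k A N) where
  smul_assoc c a f := by ext; simp

end

variable {N : Type u} [AddCommGroup N] [Module k N] [Module A N] [IsScalarTower k A N]
variable {N' : Type u} [AddCommGroup N'] [Module k N'] [Module A N'] [IsScalarTower k A N']
variable {N'' : Type u} [AddCommGroup N''] [Module k N''] [Module A N''] [IsScalarTower k A N'']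

def nlk (f : N →ₗ[A] N') : N →ₗ[k] N' := f.restrictScalars k

@[simp] theorem nlk_apply (f : N →ₗ[A] N') (x : N) : nlk (k := k) f x = f x := rfl

variable (k A N) in
/-- unit `N → Hom_k(A, N)` -/
def NLCo.ι : N →ₗ[A] NLCo k A N where
  toFun n := NLCo.mk ((LinearMap.toSpanSingleton A N n).restrictScalars k)
  map_add' x y := by ext; simp
  map_smul' a x := by ext; simp [mul_smul]

@[simp] theorem NLCo.ι_ev (n : N) (a : A) : (NLCo.ι k A N n).ev a = a • n := rfl

theorem NLCo.ι_inj : Function.Injective (NLCo.ι k A N) := by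
  intro x y h
  have := congrArg (fun f => NLCo.ev f 1) h
  simpa using this

/-- functoriality -/
def NLCo.map (φ : N →ₗ[A] N') : NLCo k A N →ₗ[A] NLCo k A N' where
  toFun f := NLCo.mk (nlk φ ∘ₗ f.ev)
  map_add' x y := by ext; simp
  map_smul' a x := by ext; simp

@[simp] theorem NLCo.map_ev (φ : N →ₗ[A] N') (f : NLCo k A N) (a : A) :
    (NLCo.map φ f).ev a = φ (f.ev a) := rfl

/-- extension property: an A-linear map to the coinduced module -/
def NLCo.lift {V : Type u} [AddCommGroup V] [Module k V]
    {M : Type u} [AddCommGroup M] [Module k M] [Module A M] [IsScalarTower k A M]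
    (f : M →ₗ[k] V) : M →ₗ[A] NLCo k A V where
  toFun m := NLCo.mk (f ∘ₗ (LinearMap.toSpanSingleton A M m).restrictScalars k)
  map_add' x y := by ext; simp
  map_smul' a x := by ext; simp [mul_smul]

@[simp] theorem NLCo.lift_ev {V : Type u} [AddCommGroup V] [Module k V]
    {M : Type u} [AddCommGroup M] [Module k M] [Module A M]
    [IsScalarTower k A M]
    (f : M →ₗ[k] V) (m : M) (a : A) : (NLCo.lift (A := A) f m).ev a = f (a • m) := rfl

/-- coinduced modules are injective; factorisation through a map with kernel condition -/
theorem NLCo.factor {V : Type u} [AddCommGroup V] [Module k V]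
    {M M' : Type u} [AddCommGroup M] [Module A M] [AddCommGroup M'] [Module A M']
    (j : M →ₗ[A] M') (f : M →ₗ[A] NLCo k A V) (h : ∀ x, j x = 0 → f x = 0) :
    ∃ g : M' →ₗ[A] NLCo k A V, ∀ x, g (j x) = f x := by
  let _ : Module k M := Module.compHom M (algebraMap k A)
  let _ : Module k M' := Module.compHom M' (algebraMap k A)
  have : IsScalarTower k A M := ⟨fun c a x => by
    change (c • a) • x = algebraMap k A c • a • x
    rw [Algebra.smul_def, mul_smul]⟩
  have : IsScalarTower k A M' := ⟨fun c a x => by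
    change (c • a) • x = algebraMap k A c • a • x
    rw [Algebra.smul_def, mul_smul]⟩
  let f1 : M →ₗ[k] V :=
    { toFun := fun m => (f m).ev 1
      map_add' := by intro x y; simp
      map_smul' := by
        intro c x
        have : f (c • x) = c • f x := (f.restrictScalars k).map_smul c x
        simp [this] }
  have hk : LinearMap.ker (nlk (k := k) j) ≤ LinearMap.ker f1 := by
    intro x hx
    have := h x (by simpa using hx)
    simp [f1, this]
  obtain ⟨g1, hg1⟩ : ∃ g1 : M' →ₗ[k] V, g1 ∘ₗ nlk (k := k) j = f1 := by
    obtain ⟨q, hq⟩ := ((LinearMap.ker (nlk (k := k) j)).liftQ (nlk (k := k) j) le_rfl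
      ).exists_leftInverse_of_injective (Submodule.ker_liftQ_eq_bot _ _ _ le_rfl)
    refine ⟨(LinearMap.ker (nlk (k := k) j)).liftQ f1 hk ∘ₗ q, ?_⟩
    ext x
    have := LinearMap.congr_fun hq (Submodule.Quotient.mk x)
    simp only [LinearMap.comp_apply, Submodule.liftQ_apply, LinearMap.id_apply] at this ⊢
    rw [this, Submodule.liftQ_apply]
  refine ⟨NLCo.lift g1, fun x => ?_⟩
  ext a
  have := LinearMap.congr_fun hg1 (a • x)
  simp only [LinearMap.comp_apply, nlk_apply, map_smul] at this
  simp [this, f1]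

variable (k A N) in
/-- cosyzygy -/
abbrev NLOm : Type u := NLCo k A N ⧸ LinearMap.range (NLCo.ι k A N)

variable (k A N) in
/-- projection to the cosyzygy -/
def NLOm.π : NLCo k A N →ₗ[A] NLOm k A N := Submodule.mkQ _

theorem NLOm.π_surj : Function.Surjective (NLOm.π k A N) := Submodule.mkQ_surjective _

theorem NLOm.π_zero (x : NLCo k A N) : NLOm.π k A N x = 0 ↔ ∃ y, NLCo.ι k A N y = x := by
  simp [NLOm.π]

theorem NLCo.map_ι (φ : N →ₗ[A] N') (n : N) :
    NLCo.map φ (NLCo.ι k A N n) = NLCo.ι k A N' (φ n) := by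
  ext; simp

/-- functoriality of the cosyzygy -/
def NLOm.map (φ : N →ₗ[A] N') : NLOm k A N →ₗ[A] NLOm k A N' :=
  Submodule.mapQ _ _ (NLCo.map φ) (by
    rintro _ ⟨n, rfl⟩
    exact ⟨φ n, (NLCo.map_ι φ n).symm⟩)

theorem NLOm.map_π (φ : N →ₗ[A] N') (x : NLCo k A N) :
    NLOm.map φ (NLOm.π k A N x) = NLOm.π k A N' (NLCo.map φ x) := rfl

/-- short exact sequences -/
def NLSES (a : N' →ₗ[A] N) (b : N →ₗ[A] N'') : Prop :=
  Function.Injective a ∧ Function.Surjective b ∧ ∀ x, b x = 0 ↔ ∃ y, a y = x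

theorem NLOm.ses : NLSES (NLCo.ι k A N) (NLOm.π k A N) :=
  ⟨NLCo.ι_inj, NLOm.π_surj, NLOm.π_zero⟩

theorem NLCo.map_ses {a : N' →ₗ[A] N} {b : N →ₗ[A] N''} (h : NLSES a b) :
    NLSES (NLCo.map (k := k) a) (NLCo.map (k := k) b) := by
  obtain ⟨ha, hb, hab⟩ := h
  obtain ⟨r, σ, hra, hbs, h1⟩ := nl_split (nlk (k := k) a) (nlk (k := k) b) ha hb hab
  refine ⟨fun x y hxy => ?_, fun y => ⟨NLCo.mk (σ ∘ₗ y.ev), ?_⟩, fun x => ⟨fun hx => 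
    ⟨NLCo.mk (r ∘ₗ x.ev), ?_⟩, ?_⟩⟩
  · ext c
    have := congrArg (fun f => NLCo.ev f c) hxy
    exact ha (by simpa using this)
  · ext c
    simpa using LinearMap.congr_fun hbs (y.ev c)
  · ext c
    have h2 := LinearMap.congr_fun h1 (x.ev c)
    have h3 := congrArg (fun f => NLCo.ev f c) hx
    simp only [NLCo.map_ev, NLCo.ev_zero] at h3
    simpa [h3] using h2
  · rintro ⟨y, rfl⟩
    ext c
    simp [(hab (a (y.ev c))).2 ⟨_, rfl⟩]

theorem NLOm.map_ses {a : N' →ₗ[A] N} {b : N →ₗ[A] N''} (h : NLSES a b) :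
    NLSES (NLOm.map (k := k) a) (NLOm.map (k := k) b) := by
  obtain ⟨ha', hb', hab'⟩ := NLCo.map_ses (k := k) h
  obtain ⟨ha, hb, hab⟩ := h
  refine ⟨?_, fun y => ?_, fun x => ⟨fun hx => ?_, ?_⟩⟩
  · rw [← LinearMap.ker_eq_bot, LinearMap.ker_eq_bot']
    intro x hx
    obtain ⟨x, rfl⟩ := NLOm.π_surj x
    rw [NLOm.map_π, NLOm.π_zero] at hx
    obtain ⟨n, hn⟩ := hx
    have : b n = 0 := by
      apply NLCo.ι_inj (k := k) (A := A)
      rw [← NLCo.map_ι, hn, map_zero]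
      exact (hab' _).2 ⟨_, rfl⟩
    obtain ⟨m, rfl⟩ := (hab n).1 this
    rw [NLOm.π_zero]
    exact ⟨m, ha' (by rw [← hn, NLCo.map_ι])⟩
  · obtain ⟨y, rfl⟩ := NLOm.π_surj y
    obtain ⟨x, rfl⟩ := hb' y
    exact ⟨NLOm.π k A N x, rfl⟩
  · obtain ⟨x, rfl⟩ := NLOm.π_surj x
    rw [NLOm.map_π, NLOm.π_zero] at hx
    obtain ⟨n, hn⟩ := hx
    obtain ⟨m, rfl⟩ := hb n
    obtain ⟨y, hy⟩ := (hab' (x - NLCo.ι k A N m)).1 (by rw [map_sub, NLCo.map_ι, hn, sub_self])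
    refine ⟨NLOm.π k A N' y, ?_⟩
    rw [NLOm.map_π, hy, map_sub, (NLOm.π_zero (NLCo.ι k A N m)).2 ⟨_, rfl⟩, sub_zero]
  · rintro ⟨y, rfl⟩
    obtain ⟨y, rfl⟩ := NLOm.π_surj y
    rw [NLOm.map_π, NLOm.map_π, (hab' _).2 ⟨_, rfl⟩, map_zero]

end NLCo

section NLLift
variable {k : Type u} [Field k] {A : Type u} [Ring A] [Algebra k A]
variable {P : ℕ → ModuleCat.{u} A} (f : ∀ i, P (i+1) →ₗ[A] P i)

/-- vanishing of Ext^{i+1}(S, N) -/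
def NLX (i : ℕ) (N : Type u) [AddCommGroup N] [Module A N] : Prop :=
  ∀ h : P (i+1) →ₗ[A] N, (∀ x, h (f (i+1) x) = 0) → ∃ h' : P i →ₗ[A] N, ∀ x, h' (f i x) = h x

variable {N : Type u} [AddCommGroup N] [Module k N] [Module A N] [IsScalarTower k A N]
variable {N' : Type u} [AddCommGroup N'] [Module k N'] [Module A N'] [IsScalarTower k A N']
variable {N'' : Type u} [AddCommGroup N''] [Module k N''] [Module A N''] [IsScalarTower k A N'']

theorem NLX.co (hf : ∀ i, LinearMap.ker (f i) = LinearMap.range (f (i+1))) (i : ℕ)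
    (V : Type u) [AddCommGroup V] [Module k V] : NLX f i (NLCo k A V) := by
  intro h hh
  apply NLCo.factor
  intro x hx
  have : x ∈ LinearMap.range (f (i+1)) := by rw [← hf]; exact hx
  obtain ⟨y, rfl⟩ := this
  exact hh y

/-- factor a map landing in the image of an injective map -/
theorem nl_through {M : Type u} [AddCommGroup M] [Module A M] (a : N' →ₗ[A] N)
    (ha : Function.Injective a) (u : M →ₗ[A] N) (h : ∀ x, ∃ y, a y = u x) :
    ∃ v : M →ₗ[A] N', ∀ x, a (v x) = u x := by
  choose v hv using h
  exact ⟨{ toFun := v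
           map_add' := fun x y => ha (by simp [hv])
           map_smul' := fun c x => ha (by simp [hv]) }, hv⟩

/-- descend along a surjection -/
theorem nl_desc {M M' : Type u} [AddCommGroup M] [Module A M] [AddCommGroup M'] [Module A M']
    (g : M →ₗ[A] M') (hg : Function.Surjective g) (u : M →ₗ[A] N)
    (h : ∀ x, g x = 0 → u x = 0) : ∃ v : M' →ₗ[A] N, ∀ x, v (g x) = u x := by
  choose t ht using hg
  have key : ∀ x y, g x = g y → u x = u y := fun x y hxy => by
    rw [← sub_eq_zero, ← map_sub]; apply h; rw [map_sub, hxy, sub_self]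
  refine ⟨{ toFun := fun y => u (t y)
            map_add' := fun x y => ?_
            map_smul' := fun c x => ?_ }, fun x => ?_⟩
  · rw [← map_add]; apply key; simp [ht]
  · rw [RingHom.id_apply, ← map_smul]; apply key; simp [ht]
  · apply key; simp [ht]

theorem NLX.om (hf : ∀ i, LinearMap.ker (f i) = LinearMap.range (f (i+1)))
    (hP : ∀ i, Module.Projective A (P i)) (i : ℕ) (hN : NLX f (i+1) N) :
    NLX f i (NLOm k A N) := by
  intro h hh
  have hff : ∀ i x, f i (f (i+1) x) = 0 := fun i x => by
    have : f (i+1) x ∈ LinearMap.ker (f i) := by rw [hf]; exact ⟨x, rfl⟩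
    exact this
  have := hP (i+1)
  obtain ⟨h1, hh1⟩ := Module.projective_lifting_property (NLOm.π k A N) h NLOm.π_surj
  have hh1' : ∀ x, NLOm.π k A N (h1 x) = h x := LinearMap.congr_fun hh1
  obtain ⟨w, hw⟩ := nl_through (NLCo.ι k A N) NLCo.ι_inj (h1 ∘ₗ f (i+1)) (fun x => by
    apply (NLOm.π_zero _).1
    simp [hh1', hh])
  obtain ⟨w', hw'⟩ := hN w (fun x => NLCo.ι_inj (k := k) (A := A) (by rw [hw]; simp [hff]))
  obtain ⟨v, hv⟩ := NLX.co f hf i N (h1 - NLCo.ι k A N ∘ₗ w') (fun x => by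
    simp [hw', hw])
  refine ⟨NLOm.π k A N ∘ₗ v, fun x => ?_⟩
  simp [hv, hh1', (NLOm.π_zero (NLCo.ι k A N (w' x))).2 ⟨_, rfl⟩]

variable {S E : Type u} [AddCommGroup S] [Module A S] [AddCommGroup E] [Module A E]

/-- Lifting property: `Ext^1(S,N)=0`. -/
def NLY (k : Type u) [Field k] (A : Type u) [Ring A] [Algebra k A]
    (S : Type u) [AddCommGroup S] [Module A S]
    (N : Type u) [AddCommGroup N] [Module k N] [Module A N] [IsScalarTower k A N] : Prop :=
  ∀ α : S →ₗ[A] NLOm k A N, ∃ β : S →ₗ[A] NLCo k A N, ∀ x, NLOm.π k A N (β x) = α x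

theorem NLX.toY (g : P 0 →ₗ[A] S)
    (hP : ∀ i, Module.Projective A (P i)) (hg : Function.Surjective g)
    (hg0 : LinearMap.ker g = LinearMap.range (f 0))
    (hf : ∀ i, LinearMap.ker (f i) = LinearMap.range (f (i+1)))
    (hN : NLX f 0 N) : NLY k A S N := by
  intro α
  have hff : ∀ i x, f i (f (i+1) x) = 0 := fun i x => by
    have : f (i+1) x ∈ LinearMap.ker (f i) := by rw [hf]; exact ⟨x, rfl⟩
    exact this
  have hgf : ∀ x, g (f 0 x) = 0 := fun x => by
    have : f 0 x ∈ LinearMap.ker g := by rw [hg0]; exact ⟨x, rfl⟩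
    exact this
  have := hP 0
  obtain ⟨h1, hh1⟩ := Module.projective_lifting_property (NLOm.π k A N) (α ∘ₗ g) NLOm.π_surj
  have hh1' : ∀ x, NLOm.π k A N (h1 x) = α (g x) := LinearMap.congr_fun hh1
  obtain ⟨w, hw⟩ := nl_through (NLCo.ι k A N) NLCo.ι_inj (h1 ∘ₗ f 0) (fun x => by
    apply (NLOm.π_zero _).1
    simp [hh1', hgf])
  obtain ⟨w', hw'⟩ := hN w (fun x => NLCo.ι_inj (k := k) (A := A) (by rw [hw]; simp [hff]))
  obtain ⟨v, hv⟩ := nl_desc g hg (h1 - NLCo.ι k A N ∘ₗ w') (fun x hx => by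
    have : x ∈ LinearMap.range (f 0) := by rw [← hg0]; exact hx
    obtain ⟨y, rfl⟩ := this
    simp [hw', hw])
  refine ⟨v, fun x => ?_⟩
  obtain ⟨x, rfl⟩ := hg x
  simp [hv, hh1', (NLOm.π_zero (NLCo.ι k A N (w' x))).2 ⟨_, rfl⟩]

theorem NLY.ext (i : S →ₗ[A] E) (p : E →ₗ[A] S) (h : NLSES i p) (hN : NLY k A S N) :
    NLY k A E N := by
  obtain ⟨hi, hp, hip⟩ := h
  intro α
  obtain ⟨β, hβ⟩ := hN (α ∘ₗ i)
  obtain ⟨β', hβ'⟩ := NLCo.factor i β (fun x hx => by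
    rw [hi (hx.trans (map_zero i).symm), map_zero])
  obtain ⟨γ, hγ⟩ := nl_desc p hp (α - NLOm.π k A N ∘ₗ β') (fun x hx => by
    obtain ⟨y, rfl⟩ := (hip x).1 hx
    simp [hβ', hβ])
  obtain ⟨δ, hδ⟩ := hN γ
  exact ⟨β' + δ ∘ₗ p, fun x => by simp [hδ, hγ]⟩

/-- extension along the inclusion -/
theorem NLY.extend (i : S →ₗ[A] E) (p : E →ₗ[A] S) (h : NLSES i p) (hN : NLY k A S N)
    (γ : S →ₗ[A] N) : ∃ γ' : E →ₗ[A] N, ∀ x, γ' (i x) = γ x := by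
  obtain ⟨hi, hp, hip⟩ := h
  obtain ⟨β, hβ⟩ := NLCo.factor i (NLCo.ι k A N ∘ₗ γ) (fun x hx => by
    rw [hi (hx.trans (map_zero i).symm), map_zero])
  obtain ⟨η, hη⟩ := nl_desc p hp (NLOm.π k A N ∘ₗ β) (fun x hx => by
    obtain ⟨y, rfl⟩ := (hip x).1 hx
    simp [hβ, (NLOm.π_zero (NLCo.ι k A N (γ y))).2 ⟨_, rfl⟩])
  obtain ⟨η', hη'⟩ := hN η
  obtain ⟨v, hv⟩ := nl_through (NLCo.ι k A N) NLCo.ι_inj (β - η' ∘ₗ p) (fun x => by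
    apply (NLOm.π_zero _).1
    simp [hη', hη])
  refine ⟨v, fun x => NLCo.ι_inj (k := k) (A := A) ?_⟩
  rw [hv]
  simp [hβ, (hip (i x)).2 ⟨_, rfl⟩]

/-- general lifting -/
theorem NLY.lift {N : Type u} [AddCommGroup N] [Module A N]
    {N'' : Type u} [AddCommGroup N''] [Module A N''] {a : N' →ₗ[A] N} {b : N →ₗ[A] N''} (h : NLSES a b) (hN : NLY k A E N')
    (α : E →ₗ[A] N'') : ∃ β : E →ₗ[A] N, ∀ x, b (β x) = α x := by
  obtain ⟨ha, hb, hab⟩ := h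
  obtain ⟨ψ, hψ⟩ := NLCo.factor a (NLCo.ι k A N') (fun x hx => by
    rw [ha (hx.trans (map_zero a).symm), map_zero])
  obtain ⟨ψ', hψ'⟩ := nl_desc b hb (NLOm.π k A N' ∘ₗ ψ) (fun x hx => by
    obtain ⟨y, rfl⟩ := (hab x).1 hx
    simp [hψ, (NLOm.π_zero (NLCo.ι k A N' y)).2 ⟨_, rfl⟩])
  obtain ⟨δ, hδ⟩ := hN (ψ' ∘ₗ α)
  have hba : ∀ x, b (a x) = 0 := fun x => (hab _).2 ⟨x, rfl⟩
  obtain ⟨v, hv⟩ := nl_through (b.prod ψ) (by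
    rw [← LinearMap.ker_eq_bot, LinearMap.ker_eq_bot']
    intro x hx
    simp only [LinearMap.prod_apply, Function.prod_apply, Prod.mk_eq_zero] at hx
    obtain ⟨y, rfl⟩ := (hab x).1 hx.1
    rw [hψ] at hx
    rw [NLCo.ι_inj (hx.2.trans (map_zero _).symm), map_zero]) (α.prod δ) (fun x => by
    obtain ⟨n, hn⟩ := hb (α x)
    obtain ⟨m, hm⟩ := (NLOm.π_zero (δ x - ψ n)).1 (by
      have := hψ' n
      simp only [LinearMap.comp_apply] at this
      rw [map_sub, hδ, ← this, hn]; simp)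
    refine ⟨n + a m, ?_⟩
    simp [hba, hn, hψ, hm])
  exact ⟨v, fun x => congrArg Prod.fst (hv x)⟩

end NLLift

section NLTrace
variable {k : Type u} [Field k] {A : Type u} [Ring A] [Algebra k A]
variable {N : Type u} [AddCommGroup N] [Module k N] [Module A N] [IsScalarTower k A N]
variable {N' : Type u} [AddCommGroup N'] [Module k N'] [Module A N'] [IsScalarTower k A N']
variable {N'' : Type u} [AddCommGroup N''] [Module k N''] [Module A N''] [IsScalarTower k A N'']
variable {S E : Type u} [AddCommGroup S] [Module A S] [AddCommGroup E] [Module A E]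

instance nl_fd_hom [Module k E] [IsScalarTower k A E] [FiniteDimensional k E]
    [FiniteDimensional k N] : FiniteDimensional k (E →ₗ[A] N) :=
  Module.Finite.of_injective (LinearMap.restrictScalarsₗ k A E N k)
    (LinearMap.restrictScalars_injective _)

variable (k N) in
/-- precomposition -/
def nlPre (ε : E →ₗ[A] E) : Module.End k (E →ₗ[A] N) where
  toFun f := f ∘ₗ ε
  map_add' _ _ := rfl
  map_smul' _ _ := rfl

variable (k E) in
/-- postcomposition -/
def nlPost (φ : N →ₗ[A] N') : (E →ₗ[A] N) →ₗ[k] (E →ₗ[A] N') where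
  toFun f := φ ∘ₗ f
  map_add' x y := by ext; simp
  map_smul' c x := by ext e; exact (nlk (k := k) φ).map_smul c (x e)

@[simp] theorem nlPre_apply (ε : E →ₗ[A] E) (f : E →ₗ[A] N) (e : E) :
    nlPre k N ε f e = f (ε e) := rfl

@[simp] theorem nlPost_apply (φ : N →ₗ[A] N') (f : E →ₗ[A] N) (e : E) :
    nlPost k E φ f e = φ (f e) := rfl

open Classical in
/-- second component of the dual-number trace -/
noncomputable def nlb {H : Type u} [AddCommGroup H] [Module k H] (ε φ : Module.End k H) : k :=
  if h : ∃ s : Module.End k H, s * ε + ε * s = 1 then LinearMap.trace k H (h.choose * φ) else 0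

theorem nlb_eq {H : Type u} [AddCommGroup H] [Module k H] (ε φ s : Module.End k H)
    (hs : s * ε + ε * s = 1) (hφ : φ * ε = ε * φ) : nlb ε φ = LinearMap.trace k H (s * φ) := by
  have h : ∃ s : Module.End k H, s * ε + ε * s = 1 := ⟨s, hs⟩
  rw [nlb, dif_pos h]
  exact nl_indep ε _ _ φ h.choose_spec hs hφ

theorem nlb_zero {H : Type u} [AddCommGroup H] [Module k H] (ε : Module.End k H) :
    nlb ε 0 = 0 := by
  rw [nlb]; split_ifs <;> simp

theorem nl_comm (ε : E →ₗ[A] E) (φ : N →ₗ[A] N) :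
    nlPost k E φ * nlPre k N ε = nlPre k N ε * nlPost k E φ := rfl

/-- the iterated trace -/
noncomputable def NLt (k : Type u) [Field k] {A : Type u} [Ring A] [Algebra k A]
    {E : Type u} [AddCommGroup E] [Module A E] (ε : E →ₗ[A] E) :
    ℕ → ∀ (N : Type u) [AddCommGroup N] [Module k N] [Module A N] [IsScalarTower k A N],
      (N →ₗ[A] N) → k
  | 0, N, _, _, _, _, φ => nlb (nlPre k N ε) (nlPost k E φ)
  | d+1, N, _, _, _, _, φ => - NLt k ε d (NLOm k A N) (NLOm.map φ)

theorem NLt_zero (ε : E →ₗ[A] E) (d : ℕ) : ∀ (N : Type u) [AddCommGroup N] [Module k N]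
    [Module A N] [IsScalarTower k A N], NLt k ε d N (0 : N →ₗ[A] N) = 0 := by
  induction d with
  | zero =>
    intro N _ _ _ _
    have : nlPost k E (0 : N →ₗ[A] N) = 0 := rfl
    rw [NLt, this, nlb_zero]
  | succ d ih =>
    intro N _ _ _ _
    have : NLOm.map (k := k) (0 : N →ₗ[A] N) = 0 := by
      ext x
      rfl
    rw [NLt, this, ih, neg_zero]

theorem NLY.contr {i : S →ₗ[A] E} {p : E →ₗ[A] S} (h : NLSES i p) (hN : NLY k A S N) :
    ∃ s : Module.End k (E →ₗ[A] N),
      s * nlPre k N (i ∘ₗ p) + nlPre k N (i ∘ₗ p) * s = 1 := by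
  apply nl_contr
  intro x
  constructor
  · intro hx
    obtain ⟨γ, hγ⟩ := nl_desc p h.2.1 x (fun e he => by
      obtain ⟨y, rfl⟩ := (h.2.2 e).1 he
      obtain ⟨z, rfl⟩ := h.2.1 y
      simpa using LinearMap.congr_fun hx z)
    obtain ⟨γ', hγ'⟩ := NLY.extend i p h hN γ
    refine ⟨γ', ?_⟩
    ext e
    simp [hγ', hγ]
  · rintro ⟨y, rfl⟩
    ext e
    simp [(h.2.2 (i (p e))).2 ⟨_, rfl⟩]

theorem NLt_add0 [Module k E] [IsScalarTower k A E] [FiniteDimensional k E]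
    [FiniteDimensional k N] [FiniteDimensional k N'] [FiniteDimensional k N'']
    {i : S →ₗ[A] E} {p : E →ₗ[A] S} (h : NLSES i p)
    {a : N' →ₗ[A] N} {b : N →ₗ[A] N''} (hab : NLSES a b)
    (φ' : N' →ₗ[A] N') (φ : N →ₗ[A] N) (φ'' : N'' →ₗ[A] N'')
    (h1 : φ ∘ₗ a = a ∘ₗ φ') (h2 : b ∘ₗ φ = φ'' ∘ₗ b)
    (hN' : NLY k A S N') (hN'' : NLY k A S N'') :
    NLt k (i ∘ₗ p) 0 N φ = NLt k (i ∘ₗ p) 0 N' φ' + NLt k (i ∘ₗ p) 0 N'' φ'' := by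
  obtain ⟨s', hs'⟩ := hN'.contr h
  obtain ⟨s'', hs''⟩ := hN''.contr h
  have hpi : ∀ x, p (i x) = 0 := fun x => (h.2.2 _).2 ⟨x, rfl⟩
  obtain ⟨s, hs, ht⟩ := nl_exists (nlPost k E a) (nlPost k E b)
    (fun x y hxy => by
      ext e; exact hab.1 (LinearMap.congr_fun hxy e))
    (fun y => by
      obtain ⟨β, hβ⟩ := NLY.lift hab (NLY.ext i p h hN') y
      exact ⟨β, LinearMap.ext hβ⟩)
    (fun x => by
      constructor
      · intro hx
        obtain ⟨v, hv⟩ := nl_through a hab.1 x (fun e => (hab.2.2 _).1 (LinearMap.congr_fun hx e))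
        exact ⟨v, LinearMap.ext hv⟩
      · rintro ⟨y, rfl⟩
        ext e
        exact (hab.2.2 _).2 ⟨_, rfl⟩)
    (nlPre k N' (i ∘ₗ p)) s' (nlPost k E φ') (nlPre k N (i ∘ₗ p)) (nlPost k E φ)
    (nlPre k N'' (i ∘ₗ p)) s'' (nlPost k E φ'')
    (by ext x e; simp [hpi]) rfl rfl
    (by ext x e; exact LinearMap.congr_fun h1 (x e))
    (by ext x e; exact LinearMap.congr_fun h2 (x e)) hs' hs''
  rw [NLt, NLt, NLt, nlb_eq _ _ s hs (nl_comm _ _), nlb_eq _ _ s' hs' (nl_comm _ _),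
    nlb_eq _ _ s'' hs'' (nl_comm _ _), ht]

variable {P : ℕ → ModuleCat.{u} A} (f : ∀ i, P (i+1) →ₗ[A] P i)

theorem NLt_add [Module k E] [IsScalarTower k A E] [FiniteDimensional k E]
    [FiniteDimensional k A]
    {i : S →ₗ[A] E} {p : E →ₗ[A] S} (h : NLSES i p) (g : P 0 →ₗ[A] S)
    (hP : ∀ i, Module.Projective A (P i)) (hg : Function.Surjective g)
    (hg0 : LinearMap.ker g = LinearMap.range (f 0))
    (hf : ∀ i, LinearMap.ker (f i) = LinearMap.range (f (i+1))) (d : ℕ) :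
    ∀ (N N' N'' : Type u) [AddCommGroup N] [Module k N] [Module A N] [IsScalarTower k A N]
    [AddCommGroup N'] [Module k N'] [Module A N'] [IsScalarTower k A N']
    [AddCommGroup N''] [Module k N''] [Module A N''] [IsScalarTower k A N'']
    [FiniteDimensional k N] [FiniteDimensional k N'] [FiniteDimensional k N'']
    (a : N' →ₗ[A] N) (b : N →ₗ[A] N'') (_ : NLSES a b)
    (φ' : N' →ₗ[A] N') (φ : N →ₗ[A] N) (φ'' : N'' →ₗ[A] N'')
    (_ : φ ∘ₗ a = a ∘ₗ φ') (_ : b ∘ₗ φ = φ'' ∘ₗ b)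
    (_ : NLX f d N') (_ : NLX f d N''),
    NLt k (i ∘ₗ p) d N φ = NLt k (i ∘ₗ p) d N' φ' + NLt k (i ∘ₗ p) d N'' φ'' := by
  induction d with
  | zero =>
    intro N N' N'' _ _ _ _ _ _ _ _ _ _ _ _ _ _ _ a b hab φ' φ φ'' h1 h2 hN' hN''
    exact NLt_add0 h hab φ' φ φ'' h1 h2 (hN'.toY f g hP hg hg0 hf) (hN''.toY f g hP hg hg0 hf)
  | succ d ih =>
    intro N N' N'' _ _ _ _ _ _ _ _ _ _ _ _ _ _ _ a b hab φ' φ φ'' h1 h2 hN' hN''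
    rw [NLt, NLt, NLt, ← neg_add]
    congr 1
    refine ih _ _ _ (NLOm.map a) (NLOm.map b) (NLOm.map_ses hab) _ _ _ ?_ ?_
      (hN'.om f hf hP) (hN''.om f hf hP)
    · apply LinearMap.ext
      intro x
      obtain ⟨x, rfl⟩ := NLOm.π_surj x
      simp only [LinearMap.comp_apply, NLOm.map_π]
      congr 1
      ext c
      exact LinearMap.congr_fun h1 (x.ev c)
    · apply LinearMap.ext
      intro x
      obtain ⟨x, rfl⟩ := NLOm.π_surj x
      simp only [LinearMap.comp_apply, NLOm.map_π]
      congr 1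
      ext c
      exact LinearMap.congr_fun h2 (x.ev c)

theorem NLt_nilp [Module k E] [IsScalarTower k A E] [FiniteDimensional k E]
    [FiniteDimensional k A]
    {i : S →ₗ[A] E} {p : E →ₗ[A] S} (h : NLSES i p) (g : P 0 →ₗ[A] S)
    (hP : ∀ i, Module.Projective A (P i)) (hg : Function.Surjective g)
    (hg0 : LinearMap.ker g = LinearMap.range (f 0))
    (hf : ∀ i, LinearMap.ker (f i) = LinearMap.range (f (i+1))) (d : ℕ)
    (hd : ∀ (N : Type u) [AddCommGroup N] [Module A N], NLX f d N) (n : ℕ) :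
    ∀ (N : Type u) [AddCommGroup N] [Module k N] [Module A N] [IsScalarTower k A N]
    [FiniteDimensional k N] (φ : N →ₗ[A] N) (_ : ∀ x, (φ ^ n) x = 0),
    NLt k (i ∘ₗ p) d N φ = 0 := by
  induction n with
  | zero =>
    intro N _ _ _ _ _ φ hφ
    have : φ = 0 := by
      ext x
      exact hφ (φ x)
    rw [this, NLt_zero]
  | succ n ih =>
    intro N _ _ _ _ _ φ hφ
    have : FiniteDimensional k (LinearMap.range φ) :=
      Module.Finite.of_injective (nlk (k := k) (LinearMap.range φ).subtype) Subtype.val_injective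
    let φ' : LinearMap.range φ →ₗ[A] LinearMap.range φ :=
      φ.restrict (p := LinearMap.range φ) (q := LinearMap.range φ) (fun x _ => ⟨x, rfl⟩)
    have hφ' : ∀ (m : ℕ) (x : LinearMap.range φ), ((φ' ^ m) x : N) = (φ ^ m) (x : N) := by
      intro m
      induction m with
      | zero => intro x; rfl
      | succ m ihm => intro x; rw [pow_succ, pow_succ, Module.End.mul_apply, ihm]; rfl
    rw [NLt_add f h g hP hg hg0 hf d N (LinearMap.range φ) (N ⧸ LinearMap.range φ)
      (LinearMap.range φ).subtype (LinearMap.range φ).mkQ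
      ⟨Subtype.val_injective, Submodule.mkQ_surjective _, fun x => by simp⟩ φ' φ 0 rfl
      (by ext x; simp) (hd _) (hd _), NLt_zero, add_zero]
    apply ih
    rintro ⟨x, y, rfl⟩
    apply Subtype.ext
    rw [hφ']
    have := hφ y
    rw [pow_succ] at this
    simpa using this

/-- the contraction on maps to coinduced modules -/
def nlsCo (V : Type u) [AddCommGroup V] [Module k V] [Module k E] [IsScalarTower k A E]
    (s : Module.End k E) : Module.End k (E →ₗ[A] NLCo k A V) where
  toFun x := NLCo.lift
    { toFun := fun e => (x (s e)).ev 1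
      map_add' := by intro a b; simp
      map_smul' := by
        intro c e
        have : x (c • s e) = c • x (s e) := (x.restrictScalars k).map_smul c _
        simp [this] }
  map_add' x y := by ext e a; simp
  map_smul' c x := by ext e a; simp

@[simp] theorem nlsCo_ev (V : Type u) [AddCommGroup V] [Module k V] [Module k E]
    [IsScalarTower k A E] (s : Module.End k E) (x : E →ₗ[A] NLCo k A V) (e : E) (a : A) :
    (nlsCo V s x e).ev a = (x (s (a • e))).ev 1 := rfl

theorem nlsCo_contr (V : Type u) [AddCommGroup V] [Module k V] [Module k E]
    [IsScalarTower k A E] (ε : E →ₗ[A] E) (s : Module.End k E)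
    (hs : s * nlk (k := k) ε + nlk (k := k) ε * s = 1) :
    nlsCo (A := A) V s * nlPre k (NLCo k A V) ε + nlPre k (NLCo k A V) ε * nlsCo (A := A) V s
      = 1 := by
  ext x e a
  have := LinearMap.congr_fun hs (a • e)
  simp only [LinearMap.add_apply, Module.End.mul_apply, nlk_apply, Module.End.one_apply] at this
  have h2 : (x (a • e)).ev 1 = (x e).ev a := by rw [map_smul]; simp
  rw [← this, map_add, add_comm] at h2
  simpa using h2

theorem NLt_co [Module k E] [IsScalarTower k A E] [FiniteDimensional k E]
    [FiniteDimensional k A] [FiniteDimensional k N] (ε : E →ₗ[A] E) (s : Module.End k E)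
    (hs : s * nlk (k := k) ε + nlk (k := k) ε * s = 1) (φ : N →ₗ[A] N) (n : ℕ)
    (hφ : ∀ x, (φ ^ n) x = 0) : NLt k ε 0 (NLCo k A N) (NLCo.map φ) = 0 := by
  rw [NLt, nlb_eq _ _ _ (nlsCo_contr N ε s hs) (nl_comm _ _)]
  have hc : Commute (nlsCo (A := A) N s) (nlPost k E (NLCo.map φ)) := by
    ext x e a; simp
  have hp : ∀ m x e a, (((nlPost k E (NLCo.map (k := k) φ)) ^ m) x e).ev a = (φ ^ m) ((x e).ev a) := by
    intro m
    induction m with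
    | zero => intro x e a; rfl
    | succ m ih => intro x e a; rw [pow_succ, pow_succ, Module.End.mul_apply, ih]; rfl
  have hn : IsNilpotent (nlPost k E (NLCo.map (k := k) φ)) := by
    refine ⟨n, ?_⟩
    ext x e a
    rw [hp, hφ]; rfl
  exact (LinearMap.isNilpotent_trace_of_isNilpotent (hc.isNilpotent_mul_left hn)).eq_zero

theorem NLOm.map_pow (φ : N →ₗ[A] N) (m : ℕ) (x : NLCo k A N) :
    ((NLOm.map φ) ^ m) (NLOm.π k A N x) = NLOm.π k A N (((NLCo.map φ) ^ m) x) := by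
  induction m generalizing x with
  | zero => rfl
  | succ m ih => rw [pow_succ, pow_succ, Module.End.mul_apply, NLOm.map_π, ih]; rfl

theorem NLCo.map_pow (φ : N →ₗ[A] N) (m : ℕ) (x : NLCo k A N) (a : A) :
    (((NLCo.map φ) ^ m) x).ev a = (φ ^ m) (x.ev a) := by
  induction m generalizing x with
  | zero => rfl
  | succ m ih => rw [pow_succ, pow_succ, Module.End.mul_apply, ih]; rfl

theorem NLt_shift [Module k E] [IsScalarTower k A E] [FiniteDimensional k E]
    [FiniteDimensional k A]
    {i : S →ₗ[A] E} {p : E →ₗ[A] S} (h : NLSES i p) (g : P 0 →ₗ[A] S)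
    (hP : ∀ i, Module.Projective A (P i)) (hg : Function.Surjective g)
    (hg0 : LinearMap.ker g = LinearMap.range (f 0))
    (hf : ∀ i, LinearMap.ker (f i) = LinearMap.range (f (i+1)))
    (s : Module.End k E)
    (hs : s * nlk (k := k) (i ∘ₗ p) + nlk (k := k) (i ∘ₗ p) * s = 1) (n d : ℕ) :
    ∀ (N : Type u) [AddCommGroup N] [Module k N] [Module A N] [IsScalarTower k A N]
    [FiniteDimensional k N] (φ : N →ₗ[A] N) (_ : ∀ x, (φ ^ n) x = 0) (_ : ∀ j, NLX f j N),
    NLt k (i ∘ₗ p) d N φ = NLt k (i ∘ₗ p) 0 N φ := by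
  induction d with
  | zero => intros; rfl
  | succ d ih =>
    intro N _ _ _ _ _ φ hφ hN
    have hO : ∀ j, NLX f j (NLOm k A N) := fun j => (hN (j+1)).om f hf hP
    rw [show NLt k (i ∘ₗ p) (d+1) N φ = - NLt k (i ∘ₗ p) d (NLOm k A N) (NLOm.map φ) from rfl,
      ih _ _ (fun x => by
      obtain ⟨x, rfl⟩ := NLOm.π_surj x
      rw [NLOm.map_pow]
      have : ((NLCo.map (k := k) φ) ^ n) x = 0 := by
        ext a
        rw [NLCo.map_pow, hφ]; rfl
      rw [this, map_zero]) hO]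
    have := NLt_add0 (k := k) h (NLOm.ses (k := k) (A := A) (N := N)) φ (NLCo.map φ) (NLOm.map φ)
      (LinearMap.ext fun x => NLCo.map_ι (k := k) φ x) rfl
      ((hN 0).toY f g hP hg hg0 hf) ((hO 0).toY f g hP hg hg0 hf)
    rw [NLt_co (i ∘ₗ p) s hs φ n hφ] at this
    exact (eq_neg_of_add_eq_zero_left this.symm).symm

variable (k) in
/-- right multiplication on the dual of A -/
def nlD (x : A) : NLCo k A k →ₗ[A] NLCo k A k where
  toFun α := NLCo.mk (α.ev ∘ₗ LinearMap.mulLeft k x)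
  map_add' _ _ := rfl
  map_smul' a α := by ext b; simp [mul_assoc]

@[simp] theorem nlD_ev (x : A) (α : NLCo k A k) (a : A) : (nlD k x α).ev a = α.ev (x * a) := rfl

theorem nlD_pow (x : A) (m : ℕ) (α : NLCo k A k) (a : A) :
    ((nlD k x ^ m) α).ev a = α.ev (x ^ m * a) := by
  induction m generalizing α with
  | zero => simp
  | succ m ih => rw [pow_succ, Module.End.mul_apply, ih, nlD_ev, ← mul_assoc, pow_succ']

variable (k A E) in
/-- adjunction -/
def nlAdj [Module k E] [IsScalarTower k A E] : (E →ₗ[A] NLCo k A k) ≃ₗ[k] Module.Dual k E where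
  toFun x :=
    { toFun := fun e => (x e).ev 1
      map_add' := by intro a b; simp
      map_smul' := by
        intro c e
        have : x (c • e) = c • x e := (x.restrictScalars k).map_smul c _
        simp [this] }
  map_add' _ _ := rfl
  map_smul' _ _ := rfl
  invFun y := NLCo.lift y
  left_inv x := by
    ext e a
    simp
  right_inv y := by
    ext e
    simp

@[simp] theorem nlAdj_apply [Module k E] [IsScalarTower k A E] (x : E →ₗ[A] NLCo k A k) (e : E) :
    nlAdj k A E x e = (x e).ev 1 := rfl

theorem NLt_D [Module k E] [IsScalarTower k A E] [FiniteDimensional k E]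
    (ε : E →ₗ[A] E) (s : Module.End k E)
    (hs : s * nlk (k := k) ε + nlk (k := k) ε * s = 1) (x : A) :
    NLt k ε 0 (NLCo k A k) (nlD k x) =
      LinearMap.trace k E (Algebra.lsmul k k E x * s) := by
  rw [NLt, nlb_eq _ _ _ (nlsCo_contr k ε s hs) (nl_comm _ _),
    ← LinearMap.trace_transpose' (Algebra.lsmul k k E x * s),
    ← LinearMap.trace_conj' _ (nlAdj k A E)]
  congr 1
  ext y e
  obtain ⟨y, rfl⟩ := (nlAdj k A E).surjective y
  simp [LinearEquiv.conj_apply, Module.Dual.transpose_apply]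

end NLTrace

section NLMain

theorem nl_density (k : Type u) [Field k] [IsAlgClosed k] {A : Type u} [Ring A] [Algebra k A]
    {S : Type u} [AddCommGroup S] [Module k S] [Module A S] [IsScalarTower k A S]
    [IsSimpleModule A S] [FiniteDimensional k S] (y : Module.End k S) :
    ∃ a : A, ∀ v, y v = a • v := by
  let F : Module.End (Module.End A S) S :=
    { toFun := y
      map_add' := map_add y
      map_smul' := by
        intro g m
        obtain ⟨c, rfl⟩ := (IsSimpleModule.algebraMap_end_bijective_of_isAlgClosed
          (A := A) (V := S) k).2 g
        exact y.map_smul c m }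
  have : Module.Finite (Module.End A S) S := Module.Finite.of_restrictScalars_finite k _ _
  obtain ⟨a, ha⟩ := Module.Finite.toModuleEnd_moduleEnd_surjective (R := A) (M := S) F
  exact ⟨a, fun v => (LinearMap.congr_fun ha v).symm⟩

theorem nl_trace_nilp (k : Type u) [Field k] {A : Type u} [Ring A] [Algebra k A]
    [FiniteDimensional k A] {S E : Type u} [AddCommGroup S] [Module A S]
    [AddCommGroup E] [Module A E] [Module k E] [IsScalarTower k A E] [FiniteDimensional k E]
    {P : ℕ → ModuleCat.{u} A} (f : ∀ i, P (i+1) →ₗ[A] P i)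
    {i : S →ₗ[A] E} {p : E →ₗ[A] S} (h : NLSES i p) (g : P 0 →ₗ[A] S)
    (hP : ∀ i, Module.Projective A (P i)) (hg : Function.Surjective g)
    (hg0 : LinearMap.ker g = LinearMap.range (f 0))
    (hf : ∀ i, LinearMap.ker (f i) = LinearMap.range (f (i+1)))
    (d : ℕ) (hd : ∀ i ≥ d, Subsingleton (P i)) (s : Module.End k E)
    (hs : s * nlk (k := k) (i ∘ₗ p) + nlk (k := k) (i ∘ₗ p) * s = 1) (x : A) (hx : IsNilpotent x) :
    LinearMap.trace k E (Algebra.lsmul k k E x * s) = 0 := by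
  obtain ⟨n, hn⟩ := hx
  have hD : ∀ α, (nlD k x ^ n) α = 0 := by
    intro α
    ext a
    rw [nlD_pow, hn]; simp
  rw [← NLt_D (i ∘ₗ p) s hs x, ← NLt_shift f h g hP hg hg0 hf s hs n d (NLCo k A k) (nlD k x) hD
    (fun j => NLX.co f hf j k)]
  refine NLt_nilp f h g hP hg hg0 hf d ?_ n _ _ hD
  intro N _ _ u _
  have := hd (d+1) (by omega)
  exact ⟨0, fun x => by rw [Subsingleton.elim x 0]; simp⟩

theorem nl_main (k : Type u) [Field k] [IsAlgClosed k] {A : Type u} [Ring A] [Algebra k A]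
    [FiniteDimensional k A] {S E : Type u} [AddCommGroup S] [Module A S] [IsSimpleModule A S]
    [AddCommGroup E] [Module A E]
    {P : ℕ → ModuleCat.{u} A} (f : ∀ i, P (i+1) →ₗ[A] P i)
    {i : S →ₗ[A] E} {p : E →ₗ[A] S} (h : NLSES i p) (g : P 0 →ₗ[A] S)
    (hP : ∀ i, Module.Projective A (P i)) (hg : Function.Surjective g)
    (hg0 : LinearMap.ker g = LinearMap.range (f 0))
    (hf : ∀ i, LinearMap.ker (f i) = LinearMap.range (f (i+1)))
    (d : ℕ) (hd : ∀ i ≥ d, Subsingleton (P i)) :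
    ∃ r : E →ₗ[A] S, ∀ x, r (i x) = x := by
  let _ : Module k S := Module.compHom S (algebraMap k A)
  let _ : Module k E := Module.compHom E (algebraMap k A)
  have : IsScalarTower k A S := ⟨fun c a x => by
    change (c • a) • x = algebraMap k A c • a • x
    rw [Algebra.smul_def, mul_smul]⟩
  have : IsScalarTower k A E := ⟨fun c a x => by
    change (c • a) • x = algebraMap k A c • a • x
    rw [Algebra.smul_def, mul_smul]⟩
  have : FiniteDimensional k S := Module.Finite.trans A S
  have hpi : ∀ x, p (i x) = 0 := fun x => (h.2.2 _).2 ⟨x, rfl⟩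
  have : FiniteDimensional k E := by
    obtain ⟨r, σ, -, -, h1⟩ := nl_split (nlk (k := k) i) (nlk (k := k) p) h.1 h.2.1 h.2.2
    refine Module.Finite.of_injective (r.prod (nlk (k := k) p)) ?_
    rw [← LinearMap.ker_eq_bot, LinearMap.ker_eq_bot']
    intro x hx
    simp only [LinearMap.prod_apply, Function.prod_apply, Prod.mk_eq_zero] at hx
    have := LinearMap.congr_fun h1 x
    simp only [LinearMap.add_apply, LinearMap.comp_apply, hx.1, hx.2, map_zero, add_zero] at this
    exact this.symm
  obtain ⟨s, hs⟩ := nl_contr (nlk (k := k) (i ∘ₗ p)) (fun x => by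
    constructor
    · intro hx
      simp only [nlk_apply, LinearMap.comp_apply] at hx
      obtain ⟨y, rfl⟩ := (h.2.2 x).1 (h.1 (hx.trans (map_zero i).symm))
      obtain ⟨z, rfl⟩ := h.2.1 y
      exact ⟨z, rfl⟩
    · rintro ⟨y, rfl⟩
      simp [hpi])
  have hpsi : ∀ x, p (s (i x)) = x := by
    intro x
    obtain ⟨z, rfl⟩ := h.2.1 x
    have := congrArg p (LinearMap.congr_fun hs z)
    simpa [hpi] using this
  have hart : IsArtinianRing A := IsArtinianRing.of_finite k A
  have hJ : ∀ x ∈ Ring.jacobson A, IsNilpotent x := by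
    intro x hx
    obtain ⟨n, hn⟩ := IsSemiprimaryRing.isNilpotent (R := A)
    refine ⟨n, ?_⟩
    have : x ^ n ∈ (Ring.jacobson A) ^ n := Ideal.pow_mem_pow hx n
    rw [hn] at this
    simpa using this
  have hJS : ∀ x ∈ Ring.jacobson A, ∀ v : S, x • v = 0 := by
    intro x hx v
    exact Module.mem_annihilator.1 (IsSemisimpleModule.jacobson_le_annihilator A S hx) v
  have hJE : ∀ x ∈ Ring.jacobson A, ∀ e : E, x • e = 0 := by
    intro x hx
    obtain ⟨δ1, hδ1⟩ := nl_through (A := k) (nlk (k := k) i) h.1 (Algebra.lsmul k k E x) (fun e =>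
      (h.2.2 _).1 (by simp [hJS x hx]))
    obtain ⟨δ, hδ⟩ := nl_desc (A := k) (nlk (k := k) p) h.2.1 δ1 (fun e he => by
      obtain ⟨y, rfl⟩ := (h.2.2 e).1 he
      apply h.1
      have := hδ1 (i y)
      simp only [nlk_apply, Algebra.lsmul_coe, ← map_smul, hJS x hx] at this
      simpa using this)
    have hxe : ∀ e, x • e = i (δ (p e)) := by
      intro e
      have h1 := hδ1 e
      have h2 := hδ e
      simp only [nlk_apply, Algebra.lsmul_coe] at h1 h2
      rw [h2, h1]
    have hδ0 : ∀ v, δ v = 0 := by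
      intro v
      rw [← Module.forall_dual_apply_eq_zero_iff k]
      intro ψ
      obtain ⟨a, ha⟩ := nl_density k (A := A) (ψ.smulRight v)
      have ht := nl_trace_nilp k f h g hP hg hg0 hf d hd s hs (a * x)
        (hJ _ (Ideal.mul_mem_left _ a hx))
      have e1 : Algebra.lsmul k k E (a * x) * s =
          nlk (k := k) i ∘ₗ ((ψ.smulRight v ∘ₗ δ) ∘ₗ nlk (k := k) p ∘ₗ s) := by
        ext e
        simp only [Module.End.mul_apply, Algebra.lsmul_coe, mul_smul, hxe, LinearMap.comp_apply,
          nlk_apply, ha, map_smul]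
      have e2 : ((ψ.smulRight v ∘ₗ δ) ∘ₗ nlk (k := k) p ∘ₗ s) ∘ₗ nlk (k := k) i =
          (ψ ∘ₗ δ).smulRight v := by
        ext e
        simp [hpsi]
      rw [e1, LinearMap.trace_comp_comm', e2, LinearMap.trace_smulRight] at ht
      exact ht
    intro e
    rw [hxe, hδ0, map_zero]
  have htor : Module.IsTorsionBySet A E (Ring.jacobson A) := fun e x => hJE x x.2 e
  have hss : IsSemisimpleModule A E := by
    let _ := htor.module
    rw [← htor.isSemisimpleModule_iff]
    infer_instance
  obtain ⟨r, hr⟩ := IsSemisimpleModule.extension_property i h.1 LinearMap.id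
  exact ⟨r, fun x => LinearMap.congr_fun hr x⟩

end NLMain

/-- The strong no loop conjecture over an algebraically closed field: let Λ be a finite
dimensional algebra over an algebraically closed field k.  If a simple right Λ-module S
has finite projective dimension, then Ext¹_Λ(S, S) = 0. -/
theorem strong_no_loop_alg_closed (k : Type u) [Field k] [IsAlgClosed k]
    (Λ : Type u) [Ring Λ] [Algebra k Λ] [FiniteDimensional k Λ]
    (S : Type u) [AddCommGroup S] [Module Λᵐᵒᵖ S] [IsSimpleModule Λᵐᵒᵖ S]
    (hfin : FinProjDim Λ S) :
    Ext1SelfVanishes Λ S := by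
  obtain ⟨P, f, g, hP, hg, hg0, hf, d, hd⟩ := hfin
  intro E _ _ i p hi hp hip
  have : FiniteDimensional k Λᵐᵒᵖ := Module.Finite.equiv (MulOpposite.opLinearEquiv k)
  refine nl_main k f (i := i) (p := p) ⟨hi, hp, fun x => ?_⟩ g hP hg hg0 hf d hd
  rw [← LinearMap.mem_ker, hip, LinearMap.mem_range]
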